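/- Let $k \ge 2$ be a natural number, let $h : \mathbb{N} \to \mathbb{Q}_{\ge 0}$ be a $k$-automatic sequence with nonnegative rational values, and let $s(n) = \sum_{j < n} h(j)$. Then there exist a real number $\beta \in (0, k)$, a real constant $C > 0$, an integer $a \ge 1$, and nonnegative rational numbers $c_0, c_1, \ldots, c_{a-1}$ such that $|s(k^{an+j}) - c_j \cdot k^{an+j}| < C \beta^{an}$ for every $n \ge 0$ and every $j \in \{0, 1, \ldots, a-1\}$. -/

import Mathlib

/-- The natural number represented by a word of base-`k` digits, most
significant digit first. -/
def wordVal (k : ℕ) (w : List (Fin k)) : ℕ :=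
  w.foldl (fun a c => k * a + (c : ℕ)) 0

/-- The language of base-`k` expansions (without leading zeros) of the
elements of a set `S ⊆ ℕ`. -/
def NatReprLang (k : ℕ) (S : Set ℕ) : Language (Fin k) :=
  { w | (∀ c ∈ w.head?, (c : ℕ) ≠ 0) ∧ wordVal k w ∈ S }

/-- A set `S ⊆ ℕ` is `k`-automatic if the language of base-`k` expansions of
its elements is accepted by a DFA. -/
def IsAutomaticSet (k : ℕ) (S : Set ℕ) : Prop :=
  (NatReprLang k S).IsRegular

/-- A sequence `h : ℕ → ℚ` is `k`-automatic if it takes finitely many values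
and for each value `q` in its range the level set `{n : h(n) = q}` is a
`k`-automatic subset of `ℕ`. -/
def IsAutomaticSeq (k : ℕ) (h : ℕ → ℚ) : Prop :=
  (Set.range h).Finite ∧ ∀ q ∈ Set.range h, IsAutomaticSet k { n | h n = q }

open Finset Matrix

section MatrixPowers

variable {X : Type*} [Fintype X] [DecidableEq X]

theorem Function.exists_iterate_idempotent {α : Type*} [Finite α] (t : α → α) :
    ∃ a, 0 < a ∧ ∀ x, t^[a] (t^[a] x) = t^[a] x := by
  obtain ⟨i, j, hij, heq⟩ : ∃ i j : ℕ, i < j ∧ t^[i] = t^[j] := by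
    obtain ⟨i, j, hne, heq⟩ := Finite.exists_ne_map_eq_of_infinite (fun n : ℕ => t^[n])
    rcases lt_or_gt_of_ne hne with h | h
    · exact ⟨i, j, h, heq⟩
    · exact ⟨j, i, h, heq.symm⟩
  obtain ⟨p, rfl⟩ := Nat.exists_eq_add_of_lt hij
  have hperiod : ∀ m n, t^[i + n] = t^[i + n + (p + 1) * m] := by
    intro m n
    induction m with
    | zero => simp
    | succ m ih =>
      rw [ih, show i + n + (p + 1) * m = i + (n + (p + 1) * m) by ring, Function.iterate_add, heq,
        ← Function.iterate_add]
      congr 1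
      ring
  refine ⟨(p + 1) * (i + 1), by positivity, fun x => ?_⟩
  have h := hperiod (i + 1) (p * (i + 1) + 1)
  rw [show i + (p * (i + 1) + 1) = (p + 1) * (i + 1) by ring] at h
  rw [← Function.iterate_add_apply, ← h]

theorem Matrix.pow_apply_iterate_pos {M : Matrix X X ℚ} (hM : ∀ x y, 0 ≤ M x y) {t : X → X}
    (ht : ∀ x, 0 < M x (t x)) (n : ℕ) (x : X) : 0 < (M ^ n) x (t^[n] x) := by
  induction n generalizing x with
  | zero => simp
  | succ n ih =>
    rw [pow_succ', Matrix.mul_apply, Function.iterate_succ_apply]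
    have hpow : ∀ (n : ℕ) (x y : X), 0 ≤ (M ^ n) x y := by
      intro n
      induction n with
      | zero => intro x y; simp only [pow_zero, Matrix.one_apply]; split_ifs <;> simp
      | succ n ih =>
        intro x y
        rw [pow_succ, Matrix.mul_apply]
        exact sum_nonneg fun z _ => mul_nonneg (ih x z) (hM z y)
    exact sum_pos' (fun z _ => mul_nonneg (hM x z) (hpow n z _))
      ⟨t x, mem_univ _, mul_pos (ht x) (ih (t x))⟩

/-- The powers of a row-stochastic matrix are bounded, so `1` is a semisimple eigenvalue. -/
theorem Matrix.sub_one_mul_eq_zero_of_sub_one_sq_mul_eq_zero {R : Matrix X X ℚ}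
    (hR : R ∈ rowStochastic ℚ X) {B : Matrix X X ℚ} (h : (R - 1) * ((R - 1) * B) = 0) :
    (R - 1) * B = 0 := by
  have hfix : R * ((R - 1) * B) = (R - 1) * B := by
    rwa [sub_mul, one_mul, sub_eq_zero] at h
  have hpow : ∀ n : ℕ, R ^ n * B = B + n • ((R - 1) * B) := by
    intro n
    induction n with
    | zero => simp
    | succ n ih =>
      rw [pow_succ', mul_assoc, ih, mul_add, mul_smul_comm, hfix, succ_nsmul, sub_mul, one_mul]
      abel
  ext x y
  have hbound : ∀ n : ℕ, (n : ℚ) * |((R - 1) * B) x y| ≤ |B x y| + ∑ z, |B z y| := by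
    intro n
    have hn : R ^ n ∈ rowStochastic ℚ X := pow_mem hR n
    have hle : |(R ^ n * B) x y| ≤ ∑ z, |B z y| := by
      rw [Matrix.mul_apply]
      refine (abs_sum_le_sum_abs _ _).trans (sum_le_sum fun z _ => ?_)
      rw [abs_mul, abs_of_nonneg (nonneg_of_mem_rowStochastic hn)]
      exact mul_le_of_le_one_left (abs_nonneg _) (le_one_of_mem_rowStochastic hn)
    rw [hpow n] at hle
    have : (n : ℚ) * ((R - 1) * B) x y = (B + n • ((R - 1) * B)) x y - B x y := by
      rw [Matrix.add_apply, Matrix.smul_apply, nsmul_eq_mul, add_sub_cancel_left]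
    rw [← Nat.abs_cast n, ← abs_mul, this]
    linarith [abs_sub ((B + n • ((R - 1) * B)) x y) (B x y)]
  by_contra hne
  have hpos : 0 < |((R - 1) * B) x y| := abs_pos.2 hne
  obtain ⟨n, hn⟩ := exists_nat_gt ((|B x y| + ∑ z, |B z y|) / |((R - 1) * B) x y|)
  rw [div_lt_iff₀ hpos] at hn
  exact absurd (hbound n) (not_le.2 hn)

/-- The rational spectral projection of a row-stochastic matrix for the eigenvalue `1`. -/
theorem Matrix.exists_fixed_projection {R : Matrix X X ℚ} (hR : R ∈ rowStochastic ℚ X) :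
    ∃ Q B : Matrix X X ℚ, R * Q = Q ∧ Q * R = Q ∧ 1 - Q = B * (R - 1) := by
  open Polynomial in
  obtain ⟨g, hg, hdvd⟩ := exists_eq_pow_rootMultiplicity_mul_and_not_dvd R.charpoly
    R.charpoly_monic.ne_zero 1
  have hg1 : g.eval 1 ≠ 0 := fun h0 => hdvd (dvd_iff_isRoot.2 h0)
  have hzero : (R - 1) ^ (R.charpoly.rootMultiplicity 1) * aeval R g = 0 := by
    have := R.aeval_self_charpoly
    rw [hg] at this
    simpa using this
  have hker : (R - 1) * aeval R g = 0 := by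
    have key : ∀ m : ℕ, (R - 1) ^ m * aeval R g = 0 → (R - 1) * aeval R g = 0 := by
      intro m
      induction m with
      | zero => intro h; rw [pow_zero, one_mul] at h; rw [h, mul_zero]
      | succ m ih =>
        intro h
        rcases m with _ | m
        · simpa using h
        · refine ih ?_
          rw [pow_succ', mul_assoc]
          refine sub_one_mul_eq_zero_of_sub_one_sq_mul_eq_zero hR ?_
          rw [← h]
          simp only [pow_succ', mul_assoc]
    exact key _ hzero
  obtain ⟨b, hb⟩ : Polynomial.X - C 1 ∣ 1 - C (g.eval 1)⁻¹ * g := by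
    rw [dvd_iff_isRoot]
    simp [hg1]
  have hRQ : R * aeval R g = aeval R g := by rwa [sub_mul, one_mul, sub_eq_zero] at hker
  have hcomm : aeval R g * R = R * aeval R g := by
    have := congrArg (aeval R) (mul_comm g Polynomial.X)
    simpa using this
  refine ⟨(g.eval 1)⁻¹ • aeval R g, aeval R b, ?_, ?_, ?_⟩
  · rw [mul_smul_comm, hRQ]
  · rw [smul_mul_assoc, hcomm, hRQ]
  · have := congrArg (aeval R) (hb.trans (mul_comm _ _))
    simpa [Algebra.smul_def] using this

/-- If a row-stochastic matrix charges the graph of an idempotent map, then its only eigenvalue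
outside the open unit disc is `1`. -/
theorem Matrix.eq_one_of_mulVec_eq_smul {R : Matrix X X ℚ} (hR : R ∈ rowStochastic ℚ X)
    {u : X → X} (hu : ∀ x, u (u x) = u x) (hpos : ∀ x, 0 < R x (u x)) {μ : ℂ} (hμ : 1 ≤ ‖μ‖)
    {f : X → ℂ} (hf : f ≠ 0) (heig : R.map (Rat.cast : ℚ → ℂ) *ᵥ f = μ • f) : μ = 1 := by
  obtain ⟨x₀, hx₀⟩ := Function.ne_iff.1 hf
  obtain ⟨x, -, hx⟩ := exists_max_image univ (fun x => ‖f x‖) ⟨x₀, mem_univ _⟩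
  have hstep : ∀ x, (∀ y, ‖f y‖ ≤ ‖f x‖) → f (u x) = μ * f x := by
    intro x hmax
    set z := μ * f x with hz
    have hzx : ‖f x‖ ≤ ‖z‖ := by
      rw [hz, norm_mul]; exact le_mul_of_one_le_left (norm_nonneg _) hμ
    have hsum : ∑ y, (R x y : ℂ) * (z - f y) = 0 := by
      have h1 : ∑ y, (R x y : ℂ) * f y = z := by
        simpa [Matrix.mulVec, dotProduct] using congrFun heig x
      have h2 : ∑ y, (R x y : ℂ) = 1 := by
        exact_mod_cast congrArg (Rat.cast : ℚ → ℂ) (sum_row_of_mem_rowStochastic hR x)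
      simp only [mul_sub, sum_sub_distrib, ← sum_mul, h1, h2, one_mul, sub_self]
    have hre : ∑ y, (R x y : ℝ) * (inner ℝ z (z - f y)) = 0 := by
      have := congrArg (fun w => inner ℝ z w) hsum
      simp only [inner_sum, inner_zero_right] at this
      rw [← this]
      refine sum_congr rfl fun y _ => ?_
      rw [← real_inner_smul_right, Complex.real_smul, Complex.ofReal_ratCast]
    have hnn : ∀ y, 0 ≤ inner ℝ z (z - f y) := by
      intro y
      rw [inner_sub_right, real_inner_self_eq_norm_sq]
      have h1 := real_inner_le_norm z (f y)
      have h2 : ‖z‖ * ‖f y‖ ≤ ‖z‖ * ‖z‖ :=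
        mul_le_mul_of_nonneg_left ((hmax y).trans hzx) (norm_nonneg _)
      nlinarith
    have hterm := (sum_eq_zero_iff_of_nonneg fun y _ => mul_nonneg
      (by exact_mod_cast nonneg_of_mem_rowStochastic hR : (0 : ℝ) ≤ R x y) (hnn y)).1 hre
      (u x) (mem_univ _)
    have hne : (R x (u x) : ℝ) ≠ 0 := by exact_mod_cast (hpos x).ne'
    have hinner : inner ℝ z (z - f (u x)) = 0 := (mul_eq_zero.1 hterm).resolve_left hne
    have hle : ‖z - f (u x)‖ ^ 2 ≤ 0 := by
      rw [inner_sub_right, real_inner_self_eq_norm_sq] at hinner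
      rw [norm_sub_sq_real]
      have : ‖f (u x)‖ ^ 2 ≤ ‖z‖ ^ 2 := by
        gcongr; exact (hmax _).trans hzx
      linarith
    have : z - f (u x) = 0 := by
      rw [← norm_eq_zero]; exact pow_eq_zero_iff two_ne_zero |>.1 (le_antisymm hle (sq_nonneg _))
    exact (sub_eq_zero.1 this).symm
  have hmax : ∀ y, ‖f y‖ ≤ ‖f x‖ := fun y => hx y (mem_univ _)
  have h1 := hstep x hmax
  have h2 := hstep (u x) fun y => (hmax y).trans <| by
    rw [h1, norm_mul]; exact le_mul_of_one_le_left (norm_nonneg _) hμ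
  have hfx : f x ≠ 0 := norm_pos_iff.1 ((norm_pos_iff.2 hx₀).trans_le (hmax x₀))
  have hμ0 : μ ≠ 0 := norm_pos_iff.1 (one_pos.trans_le hμ)
  rw [hu, h1] at h2
  exact (mul_eq_right₀ (mul_ne_zero hμ0 hfx)).1 h2.symm

attribute [local instance] Matrix.linftyOpNormedRing Matrix.linftyOpNormedAlgebra

theorem exists_norm_pow_le_of_spectrum {A : Type*} [NormedRing A] [NormedAlgebra ℂ A]
    [CompleteSpace A] [Nontrivial A] (T : A) (hT : ∀ μ ∈ spectrum ℂ T, ‖μ‖ < 1) :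
    ∃ γ C : ℝ, 0 < γ ∧ γ < 1 ∧ 0 < C ∧ ∀ n, ‖T ^ n‖ ≤ C * γ ^ n := by
  have hr : spectralRadius ℂ T < (1 : NNReal) :=
    spectrum.spectralRadius_lt_of_forall_lt T fun μ hμ => by exact_mod_cast hT μ hμ
  obtain ⟨γ, hγ, hγ1⟩ := ENNReal.lt_iff_exists_nnreal_btwn.1 hr
  have hγ0 : (0 : ℝ) < γ := by exact_mod_cast (zero_le.trans_lt hγ)
  have hlim :=
    (spectrum.pow_nnnorm_pow_one_div_tendsto_nhds_spectralRadius T).eventually_lt_const hγ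
  obtain ⟨N, hN⟩ := Filter.eventually_atTop.1 (hlim.and (Filter.eventually_gt_atTop 0))
  have hnn : ∀ n, 0 ≤ ‖T ^ n‖ / (γ : ℝ) ^ n := fun n => by positivity
  refine ⟨γ, 1 + ∑ n ∈ range N, ‖T ^ n‖ / (γ : ℝ) ^ n, hγ0, by exact_mod_cast hγ1,
    add_pos_of_pos_of_nonneg one_pos (sum_nonneg fun n _ => hnn n), fun n => ?_⟩
  rw [← div_le_iff₀ (pow_pos hγ0 n)]
  rcases lt_or_ge n N with hn | hn
  · exact (single_le_sum (fun n _ => hnn n) (mem_range.2 hn)).trans (by linarith)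
  · refine le_trans ?_ (le_add_of_nonneg_right (sum_nonneg fun n _ => hnn n))
    rw [div_le_one (pow_pos hγ0 n)]
    obtain ⟨h1, h2⟩ := hN n hn
    have h3 : ((‖T ^ n‖₊ : ENNReal) ^ (1 / n : ℝ)) ^ n ≤ (γ : ENNReal) ^ n := by gcongr
    rw [← ENNReal.rpow_natCast, ← ENNReal.rpow_mul, one_div,
      inv_mul_cancel₀ (by exact_mod_cast h2.ne'), ENNReal.rpow_one] at h3
    exact_mod_cast h3

/-- Along a suitable arithmetic progression, the powers of a rational row-stochastic matrix
converge geometrically fast to a rational matrix. -/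
theorem Matrix.exists_pow_mulVec_tendsto [Nonempty X] {M : Matrix X X ℚ}
    (hM : M ∈ rowStochastic ℚ X) :
    ∃ (a : ℕ) (Q : Matrix X X ℚ) (γ : ℝ), 0 < a ∧ 0 < γ ∧ γ < 1 ∧ ∀ v : X → ℚ, ∃ C : ℝ, 0 < C ∧
      ∀ n x, |(((M ^ (a * n) *ᵥ v) x : ℚ) : ℝ) - ((Q *ᵥ v) x : ℚ)| ≤ C * γ ^ n := by
  have hex : ∀ x, ∃ y, 0 < M x y := by
    intro x
    by_contra! hle
    have := sum_nonpos fun y (_ : y ∈ univ) => hle y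
    rw [sum_row_of_mem_rowStochastic hM x] at this
    exact absurd this (by norm_num)
  choose t ht using hex
  obtain ⟨a, ha, hu⟩ := Function.exists_iterate_idempotent t
  have hR : M ^ a ∈ rowStochastic ℚ X := pow_mem hM a
  have hpos : ∀ x, 0 < (M ^ a) x (t^[a] x) :=
    pow_apply_iterate_pos (M := M) (t := t) (fun x y => nonneg_of_mem_rowStochastic hM) ht a
  obtain ⟨Q, B, hRQ, hQR, hB⟩ := exists_fixed_projection hR
  have hQQ : Q * Q = Q := by
    have h : (1 - Q) * Q = 0 := by rw [hB, mul_assoc, sub_mul, one_mul, hRQ, sub_self, mul_zero]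
    rwa [sub_mul, one_mul, sub_eq_zero, eq_comm] at h
  let φ : Matrix X X ℚ →+* Matrix X X ℂ := (Rat.castHom ℂ).mapMatrix
  have : CompleteSpace (Matrix X X ℂ) := FiniteDimensional.complete ℂ _
  obtain ⟨γ, C, hγ0, hγ1, hC, hbound⟩ := exists_norm_pow_le_of_spectrum (φ (M ^ a - Q)) <| by
    intro μ hμ
    by_contra! hle
    rw [spectrum.mem_iff, Matrix.isUnit_iff_isUnit_det, isUnit_iff_ne_zero, not_not,
      ← Matrix.exists_mulVec_eq_zero_iff] at hμ
    obtain ⟨f, hf, hzero⟩ := hμ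
    rw [sub_mulVec, sub_eq_zero, Algebra.algebraMap_eq_smul_one, smul_mulVec, one_mulVec] at hzero
    have hμ0 : μ ≠ 0 := norm_pos_iff.1 (one_pos.trans_le hle)
    have hQf : φ Q *ᵥ f = 0 := by
      have h := congrArg (φ Q *ᵥ ·) hzero
      simp only [mulVec_mulVec, ← map_mul, mul_sub, hQR, hQQ, sub_self, map_zero, zero_mulVec,
        mulVec_smul] at h
      exact (smul_eq_zero.1 h).resolve_left hμ0
    have hRf : φ (M ^ a) *ᵥ f = μ • f := by
      rw [hzero, map_sub, sub_mulVec, hQf, sub_zero]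
    have hμ1 : μ = 1 := eq_one_of_mulVec_eq_smul hR hu hpos hle hf hRf
    apply hf
    have h := congrArg (fun A => φ A *ᵥ f) hB
    simp only [map_sub, map_mul, map_one, sub_mulVec, one_mulVec, hQf, ← mulVec_mulVec, hRf, hμ1,
      one_smul, sub_self, sub_zero, mulVec_zero] at h
    exact h
  have hpow : ∀ n, (M ^ a - Q) ^ (n + 1) = (M ^ a) ^ (n + 1) - Q := by
    intro n
    have hQpow : ∀ n, Q * (M ^ a) ^ n = Q := by
      intro n
      induction n with
      | zero => simp
      | succ n ih => rw [pow_succ, ← mul_assoc, ih, hQR]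
    induction n with
    | zero => simp
    | succ n ih =>
      rw [pow_succ', ih, sub_mul, mul_sub, mul_sub, hRQ, hQQ, hQpow, ← pow_succ']
      abel
  refine ⟨a, Q, γ, ha, hγ0, hγ1, fun v => ?_⟩
  set w : X → ℂ := fun y => (v y : ℂ)
  have hcast : ∀ (A : Matrix X X ℚ) x, (φ A *ᵥ w) x = ((A *ᵥ v) x : ℚ) := by
    intro A x
    simp [φ, w, Matrix.mulVec, dotProduct]
  have habs : ∀ (A : Matrix X X ℚ) x, |((A *ᵥ v) x : ℝ)| ≤ ‖φ A‖ * ‖w‖ := by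
    intro A x
    have h := (norm_le_pi_norm (φ A *ᵥ w) x).trans (linfty_opNorm_mulVec (φ A) w)
    rw [hcast] at h
    simpa using h
  refine ⟨(C + ‖φ (1 - Q)‖) * ‖w‖ + 1, by positivity, fun n x => ?_⟩
  rw [← Rat.cast_sub, ← Pi.sub_apply, ← sub_mulVec]
  refine (habs _ x).trans ?_
  have hγn := pow_pos hγ0 n
  have hnorm : ‖φ (M ^ (a * n) - Q)‖ ≤ (C + ‖φ (1 - Q)‖) * γ ^ n := by
    rcases n with _ | n
    · simp [hC.le]
    · rw [pow_mul, ← hpow, map_pow]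
      refine (hbound _).trans ?_
      gcongr
      simp
  calc ‖φ (M ^ (a * n) - Q)‖ * ‖w‖ ≤ (C + ‖φ (1 - Q)‖) * γ ^ n * ‖w‖ := by gcongr
    _ ≤ ((C + ‖φ (1 - Q)‖) * ‖w‖ + 1) * γ ^ n := by nlinarith

end MatrixPowers

theorem wordVal_append_singleton (k : ℕ) (w : List (Fin k)) (c : Fin k) :
    wordVal k (w ++ [c]) = k * wordVal k w + c := by
  simp [wordVal]

/-- An automatic sequence is computed by a finite automaton with output that reads base-`k`
words, possibly with leading zeros. -/
theorem IsAutomaticSeq.exists_automaton {k : ℕ} {h : ℕ → ℚ}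
    (hh : IsAutomaticSeq k h) :
    ∃ (X : Type) (_ : Fintype X) (δ : X → Fin k → X) (x₀ : X) (g : X → ℚ),
      ∀ w : List (Fin k), g (w.foldl δ x₀) = h (wordVal k w) := by
  classical
  obtain ⟨hfin, hreg⟩ := hh
  have := hfin.fintype
  choose σ hσ D hD using fun q : Set.range h => hreg q q.2
  let δ : Option (∀ q, σ q) → Fin k → Option (∀ q, σ q) := fun o c =>
    match o with
    | none => if (c : ℕ) = 0 then none else some fun q => (D q).step (D q).start c
    | some x => some fun q => (D q).step (x q) c
  have heval : ∀ w : List (Fin k), (w.foldl δ none = none ∧ wordVal k w = 0) ∨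
      ∃ v : List (Fin k), v ≠ [] ∧ (∀ c ∈ v.head?, (c : ℕ) ≠ 0) ∧ wordVal k v = wordVal k w ∧
        w.foldl δ none = some fun q => (D q).eval v := by
    intro w
    induction w using List.reverseRecOn with
    | nil => exact Or.inl ⟨rfl, rfl⟩
    | append_singleton w c ih =>
      rw [List.foldl_append, wordVal_append_singleton]
      rcases ih with ⟨h1, h2⟩ | ⟨v, hv, hhead, hval, hst⟩
      · rw [h1, h2]
        by_cases hc : (c : ℕ) = 0
        · exact Or.inl ⟨by simp [δ, hc], by simp [hc]⟩
        · exact Or.inr ⟨[c], by simp, by simpa using hc, by simp [wordVal], by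
            simp [δ, hc, DFA.eval, DFA.evalFrom]⟩
      · refine Or.inr ⟨v ++ [c], by simp, ?_, by rw [wordVal_append_singleton, hval], ?_⟩
        · rwa [List.head?_append_of_ne_nil _ hv]
        · rw [hst]
          simp [δ]
  have hmem : ∀ (q : Set.range h) (v : List (Fin k)), (∀ c ∈ v.head?, (c : ℕ) ≠ 0) →
      ((D q).eval v ∈ (D q).accept ↔ h (wordVal k v) = q) := by
    intro q v hv
    rw [← DFA.mem_accepts, hD q]
    exact and_iff_right hv
  have hwd : ∀ w w' : List (Fin k), w.foldl δ none = w'.foldl δ none →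
      h (wordVal k w) = h (wordVal k w') := by
    intro w w' heq
    rcases heval w with ⟨h1, h2⟩ | ⟨v, -, hhead, hval, hst⟩ <;>
      rcases heval w' with ⟨h1', h2'⟩ | ⟨v', -, hhead', hval', hst'⟩
    · rw [h2, h2']
    · simp [h1, hst'] at heq
    · simp [h1', hst] at heq
    · rw [hst, hst', Option.some_inj] at heq
      rw [← hval, ← hval']
      have h1 := (hmem ⟨_, wordVal k v, rfl⟩ v hhead).2 rfl
      rw [congrFun heq, hmem _ _ hhead'] at h1
      exact h1.symm
  refine ⟨_, inferInstance, δ, none, Function.extend (fun w : List (Fin k) => w.foldl δ none)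
    (fun w => h (wordVal k w)) 0, fun w => ?_⟩
  have hfac : Function.FactorsThrough (fun w => h (wordVal k w))
    (fun w : List (Fin k) => w.foldl δ none) := fun w w' heq => hwd w w' heq
  exact hfac.extend_apply 0 w

theorem Finset.sum_range_mul_eq (f : ℕ → ℚ) (k K : ℕ) :
    ∑ r ∈ range (k * K), f r = ∑ c : Fin k, ∑ r ∈ range K, f (c * K + r) := by
  rw [Fin.sum_univ_eq_sum_range (fun c => ∑ r ∈ range K, f (c * K + r)) k]
  induction k with
  | zero => simp
  | succ k ih => rw [add_mul, one_mul, sum_range_add, ih, sum_range_succ]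

section TransitionMatrix

variable {k : ℕ} {X : Type*} [Fintype X] [DecidableEq X]

/-- The transition matrix of the random walk on the states of an automaton that reads uniformly
random letters. -/
def transitionMatrix (δ : X → Fin k → X) : Matrix X X ℚ :=
  Matrix.of fun x y => ∑ c : Fin k, if δ x c = y then (k : ℚ)⁻¹ else 0

theorem transitionMatrix_mulVec (δ : X → Fin k → X) (f : X → ℚ) (x : X) :
    (transitionMatrix δ *ᵥ f) x = (k : ℚ)⁻¹ * ∑ c, f (δ x c) := by
  simp only [transitionMatrix, Matrix.mulVec, dotProduct, Matrix.of_apply, sum_mul, ite_mul,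
    zero_mul]
  rw [sum_comm]
  simp [mul_sum]

theorem transitionMatrix_mem_rowStochastic (hk : k ≠ 0) (δ : X → Fin k → X) :
    transitionMatrix δ ∈ rowStochastic ℚ X := by
  refine ⟨fun x y => ?_, ?_⟩
  · rw [transitionMatrix, Matrix.of_apply]
    refine sum_nonneg fun c _ => ?_
    split_ifs <;> positivity
  · ext x
    rw [transitionMatrix_mulVec]
    simp [hk]

theorem sum_range_pow_eq_transitionMatrix_pow_mulVec (hk : k ≠ 0) {h : ℕ → ℚ}
    {δ : X → Fin k → X} {x₀ : X} {g : X → ℚ}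
    (hg : ∀ w : List (Fin k), g (w.foldl δ x₀) = h (wordVal k w)) (N : ℕ) (w : List (Fin k)) :
    ∑ r ∈ range (k ^ N), h (wordVal k w * k ^ N + r) =
      (k : ℚ) ^ N * (transitionMatrix δ ^ N *ᵥ g) (w.foldl δ x₀) := by
  induction N generalizing w with
  | zero => simp [hg]
  | succ N ih =>
    have hk' : (k : ℚ) ≠ 0 := by exact_mod_cast hk
    rw [pow_succ' (transitionMatrix δ), ← mulVec_mulVec, transitionMatrix_mulVec, pow_succ' k,
      sum_range_mul_eq, pow_succ (k : ℚ), mul_assoc, mul_inv_cancel_left₀ hk', mul_sum]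
    refine sum_congr rfl fun c _ => ?_
    have hc := ih (w ++ [c])
    rw [List.foldl_append, wordVal_append_singleton] at hc
    simp only [List.foldl_cons, List.foldl_nil] at hc
    rw [← hc]
    refine sum_congr rfl fun r _ => congrArg h ?_
    ring

end TransitionMatrix

/-- For a `k`-automatic sequence `h : ℕ → ℚ≥0` with partial sums
`s(n) = ∑_{j<n} h(j)`, there exist `β ∈ (0, k)`, `C > 0`, an integer `a ≥ 1`
and nonnegative rationals `c₀, …, c_{a-1}` such that
`|s(k^{an+j}) - c_j k^{an+j}| < C β^{an}` for all `n ≥ 0` and `0 ≤ j < a`. -/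
theorem automatic_partial_sums_asymptotics
    (k : ℕ) (hk : 2 ≤ k) (h : ℕ → ℚ) (hh : IsAutomaticSeq k h)
    (hnonneg : ∀ n, 0 ≤ h n)
    (s : ℕ → ℚ) (hs : ∀ n, s n = ∑ j ∈ Finset.range n, h j) :
    ∃ (β C : ℝ) (a : ℕ) (c : ℕ → ℚ),
      0 < β ∧ β < k ∧ 0 < C ∧ 1 ≤ a ∧ (∀ j < a, 0 ≤ c j) ∧
      ∀ n : ℕ, ∀ j < a,
        |((s (k ^ (a * n + j)) : ℝ)) - (c j : ℝ) * (k : ℝ) ^ (a * n + j)| <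
          C * β ^ (a * n) := by
  classical
  have hk0 : k ≠ 0 := by omega
  have hkpos : (0 : ℝ) < k := by positivity
  obtain ⟨X, _, δ, x₀, g, hg⟩ := hh.exists_automaton
  set M := transitionMatrix δ with hMdef
  have : Nonempty X := ⟨x₀⟩
  have hsM : ∀ N, s (k ^ N) = (k : ℚ) ^ N * (M ^ N *ᵥ g) x₀ := by
    intro N
    have := sum_range_pow_eq_transitionMatrix_pow_mulVec hk0 hg N []
    rw [hs, ← hMdef] at *
    simpa [wordVal] using this
  have hMnonneg : ∀ N, 0 ≤ (M ^ N *ᵥ g) x₀ := by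
    intro N
    have h0 : 0 ≤ (k : ℚ) ^ N * (M ^ N *ᵥ g) x₀ := by
      rw [← hsM, hs]; exact sum_nonneg fun j _ => hnonneg j
    exact nonneg_of_mul_nonneg_right h0 (by positivity)
  obtain ⟨a, Q, γ, ha, hγ0, hγ1, hconv⟩ :=
    exists_pow_mulVec_tendsto (transitionMatrix_mem_rowStochastic hk0 δ)
  choose C hC hbound using fun j : ℕ => hconv (M ^ j *ᵥ g)
  have hbound' : ∀ j n, |(((M ^ (a * n + j) *ᵥ g) x₀ : ℚ) : ℝ) - ((Q *ᵥ (M ^ j *ᵥ g)) x₀ : ℚ)| ≤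
      C j * γ ^ n := by
    intro j n
    rw [pow_add, ← mulVec_mulVec]
    exact hbound j n x₀
  have hroot : (γ ^ (a : ℝ)⁻¹) ^ a = γ := Real.rpow_inv_natCast_pow hγ0.le ha.ne'
  refine ⟨k * γ ^ (a : ℝ)⁻¹, 1 + ∑ j ∈ range a, (k : ℝ) ^ j * C j, a,
    fun j => (Q *ᵥ (M ^ j *ᵥ g)) x₀, by positivity, ?_, ?_, ha, fun j _ => ?_, fun n j hj => ?_⟩
  · exact mul_lt_of_lt_one_right hkpos (Real.rpow_lt_one hγ0.le hγ1 (by positivity))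
  · exact add_pos_of_pos_of_nonneg one_pos
      (sum_nonneg fun j _ => mul_nonneg (by positivity) (hC j).le)
  · have hlim : Filter.Tendsto (fun n => C j * γ ^ n) Filter.atTop (nhds (C j * 0)) :=
      (tendsto_pow_atTop_nhds_zero_of_lt_one hγ0.le hγ1).const_mul _
    rw [mul_zero] at hlim
    have hle : (0 : ℝ) ≤ ((Q *ᵥ (M ^ j *ᵥ g)) x₀ : ℚ) + 0 :=
      ge_of_tendsto' (hlim.const_add _) fun n => by
        have h1 := (le_abs_self _).trans (hbound' j n)
        have h2 : (0 : ℝ) ≤ ((M ^ (a * n + j) *ᵥ g) x₀ : ℚ) := by exact_mod_cast hMnonneg _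
        linarith
    rw [add_zero] at hle
    exact_mod_cast hle
  · have hsum : (k : ℝ) ^ j * C j < 1 + ∑ j ∈ range a, (k : ℝ) ^ j * C j :=
      (single_le_sum (f := fun j => (k : ℝ) ^ j * C j)
        (fun i _ => mul_nonneg (by positivity) (hC i).le) (mem_range.2 hj)).trans_lt (by linarith)
    rw [hsM, Rat.cast_mul, Rat.cast_pow, Rat.cast_natCast, mul_comm _ ((k : ℝ) ^ (a * n + j)),
      ← mul_sub, abs_mul, abs_of_pos (by positivity), mul_pow, pow_mul (γ ^ (a : ℝ)⁻¹), hroot]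
    calc (k : ℝ) ^ (a * n + j) * _ ≤ (k : ℝ) ^ (a * n + j) * (C j * γ ^ n) := by
          gcongr; exact hbound' j n
      _ = (k : ℝ) ^ j * C j * ((k : ℝ) ^ (a * n) * γ ^ n) := by ring
      _ < _ := by gcongr
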